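/- arXiv:2011.09543 — 2 statements merged into one kernel-verified Lean document; each statement's English description precedes it below -/
import Mathlib

section
/- For every s ≥ 1 there exists a constant C > 0 such that for all Schwartz functions f, g : ℝ → ℂ one has ‖J^{-2}( f · (g - g'') )‖_{H^s} ≤ C ‖f‖_{H^s} ‖g‖_{H^s}; that is, the operator A_f = J^{-2} f J² (multiplication by f conjugated by Bessel potentials) is bounded on H^s with operator norm controlled by ‖f‖_{H^s}. Here J^{-2}h denotes the function whose Fourier transform is (1+ξ²)^{-1} ĥ(ξ), and g - g'' has Fourier transform (1+ξ²) ĝ(ξ). -/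
open MeasureTheory Filter Topology

/-- The Fourier transform `f̂(ξ) = ∫ f(x) e^{-iξx} dx`. -/
noncomputable def ft (f : ℝ → ℂ) (ξ : ℝ) : ℂ :=
  ∫ x : ℝ, f x * Complex.exp (-(Complex.I * (ξ : ℂ) * (x : ℂ)))

/-- The `H^s` norm computed from a Fourier-side function. -/
noncomputable def sobNormF (s : ℝ) (F : ℝ → ℂ) : ℝ :=
  (∫ ξ : ℝ, (1 + ξ ^ 2) ^ s * ‖F ξ‖ ^ 2) ^ (1/2 : ℝ)

/-- The `H^s` norm `‖f‖_{H^s} = (∫ (1+ξ²)^s |f̂(ξ)|² dξ)^{1/2}`. -/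
noncomputable def sobNorm (s : ℝ) (f : ℝ → ℂ) : ℝ := sobNormF s (ft f)


open FourierTransform Real

/-- The frequency-side Schwartz function. -/
theorem ft_eq (f : ℝ → ℂ) (ξ : ℝ) : ft f ξ = 𝓕 f (ξ / (2 * π)) := by
  rw [Real.fourier_real_eq_integral_exp_smul, ft]
  congr 1
  ext x
  rw [smul_eq_mul, mul_comm]
  congr 2
  push_cast
  have : (π : ℂ) ≠ 0 := by exact_mod_cast Real.pi_ne_zero
  field_simp

theorem ft_schwartz (f : SchwartzMap ℝ ℂ) : ∃ F : SchwartzMap ℝ ℂ, ∀ ξ, ft f ξ = F ξ := by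
  have h2 : (2 * π)⁻¹ ≠ 0 := by positivity
  refine ⟨SchwartzMap.compCLMOfContinuousLinearEquiv ℂ
    (ContinuousLinearEquiv.unitsEquivAut ℝ (Units.mk0 _ h2)) (𝓕 f), fun ξ => ?_⟩
  rw [ft_eq, ← SchwartzMap.fourier_coe]
  simp [div_eq_mul_inv]

theorem fourier_prod (f h : SchwartzMap ℝ ℂ) (w : ℝ) :
    𝓕 (fun x => f x * h x) w = ∫ t, 𝓕 (f : ℝ → ℂ) t * 𝓕 (h : ℝ → ℂ) (w - t) := by
  have key := SchwartzMap.convolution_apply (ContinuousLinearMap.mul ℂ ℂ) (𝓕⁻ f) (𝓕⁻ h) (-w)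
  have e1 : SchwartzMap.convolution (ContinuousLinearMap.mul ℂ ℂ) (𝓕⁻ f) (𝓕⁻ h)
      = 𝓕⁻ (SchwartzMap.pairing (ContinuousLinearMap.mul ℂ ℂ) f h) := by
    simp [SchwartzMap.convolution]
  rw [e1, SchwartzMap.fourierInv_coe, Real.fourierInv_eq_fourier_neg, neg_neg] at key
  have e2 : (⇑(SchwartzMap.pairing (ContinuousLinearMap.mul ℂ ℂ) f h)) = fun x => f x * h x := by
    ext x; simp [SchwartzMap.pairing_apply_apply]
  rw [e2] at key
  rw [key, MeasureTheory.convolution, ← integral_neg_eq_self]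
  congr 1
  ext t
  rw [SchwartzMap.fourierInv_coe, SchwartzMap.fourierInv_coe, Real.fourierInv_eq_fourier_neg,
    Real.fourierInv_eq_fourier_neg]
  simp only [ContinuousLinearMap.mul_apply']
  congr 2 <;> ring_nf

theorem ft_prod (f h : SchwartzMap ℝ ℂ) (ξ : ℝ) :
    ‖ft (fun x => f x * h x) ξ‖ₑ ≤ ∫⁻ t, ‖ft f t‖ₑ * ‖ft h (ξ - t)‖ₑ := by
  have h1 : ft (fun x => f x * h x) ξ = ((2 * π)⁻¹ : ℝ) • ∫ t, ft f t * ft h (ξ - t) := by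
    rw [ft_eq, fourier_prod]
    have := Measure.integral_comp_div
      (fun t => 𝓕 (f : ℝ → ℂ) t * 𝓕 (h : ℝ → ℂ) (ξ / (2 * π) - t)) (2 * π)
    simp only [ft_eq, sub_div]
    rw [this, smul_smul, abs_of_pos (by positivity), inv_mul_cancel₀ (by positivity), one_smul]
  rw [h1, enorm_smul]
  calc _ ≤ 1 * ∫⁻ t, ‖ft f t * ft h (ξ - t)‖ₑ := by
        gcongr
        · rw [← enorm_one (G := ℝ), enorm_le_iff_norm_le, norm_inv, norm_one]
          apply inv_le_one_of_one_le₀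
          rw [Real.norm_of_nonneg (by positivity)]
          linarith [Real.pi_gt_three]
        · exact enorm_integral_le_lintegral_enorm _
    _ = _ := by simp [enorm_mul]

theorem ft_bessel (g : SchwartzMap ℝ ℂ) : ∃ h : SchwartzMap ℝ ℂ,
    (∀ x, h x = g x - deriv (deriv (⇑g)) x) ∧ ∀ ξ, ‖ft h ξ‖ = (1 + ξ ^ 2) * ‖ft g ξ‖ := by
  let g1 := SchwartzMap.derivCLM ℂ ℂ g
  let g2 := SchwartzMap.derivCLM ℂ ℂ g1
  have c1 : ⇑g1 = deriv (⇑g) := by ext x; simp [g1]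
  have c2 : ⇑g2 = deriv (⇑g1) := by ext x; simp [g2]
  have d1 : 𝓕 (⇑g1) = fun (x : ℝ) ↦ (2 * π * Complex.I * x) • (𝓕 (⇑g) x) := by
    have := Real.fourier_deriv g.integrable g.differentiable (by rw [← c1]; exact g1.integrable)
    rwa [← c1] at this
  have d2 : 𝓕 (⇑g2) = fun (x : ℝ) ↦ (2 * π * Complex.I * x) • (𝓕 (⇑g1) x) := by
    have := Real.fourier_deriv g1.integrable g1.differentiable (by rw [← c2]; exact g2.integrable)
    rwa [← c2] at this
  refine ⟨g - g2, fun x => by rw [← c1, ← c2]; rfl, fun ξ => ?_⟩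
  have e : ft (⇑(g - g2)) ξ = ((1 + ξ ^ 2 : ℝ) : ℂ) * ft g ξ := by
    rw [ft_eq, ft_eq, ← SchwartzMap.fourier_coe, sub_eq_add_neg, FourierTransform.fourier_add,
      ← neg_one_smul ℂ, FourierTransform.fourier_smul]
    simp only [add_apply, smul_apply, SchwartzMap.fourier_coe]
    rw [d2, d1]
    have : (π : ℂ) ≠ 0 := by exact_mod_cast Real.pi_ne_zero
    simp only [smul_eq_mul]
    push_cast
    field_simp
    ring_nf
    simp only [Complex.I_sq]
    ring
  rw [e, norm_mul, Complex.norm_real, Real.norm_of_nonneg (by positivity)]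

theorem sob_integrable (s : ℝ) (f : SchwartzMap ℝ ℂ) :
    Integrable (fun ξ : ℝ => (1 + ξ ^ 2) ^ s * ‖f ξ‖ ^ 2) := by
  obtain ⟨n, hn⟩ := exists_nat_ge s
  have ht : Function.HasTemperateGrowth (fun x : ℝ => ((1 + x ^ 2) ^ n : ℝ)) := by fun_prop
  have hi : Integrable (fun ξ : ℝ => ‖f ξ‖ * ((1 + ξ ^ 2) ^ n * ‖f ξ‖)) := by
    have h1 := (SchwartzMap.smulLeftCLM ℂ (fun x : ℝ => ((1 + x ^ 2) ^ n : ℝ)) f).integrable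
      (μ := volume)
    rw [SchwartzMap.smulLeftCLM_apply ht] at h1
    have h2 := h1.norm
    refine Integrable.bdd_mul (c := SchwartzMap.seminorm ℝ 0 0 f) ?_ (by fun_prop) ?_
    · refine h2.congr (.of_forall fun x => ?_)
      simp only [norm_smul]
      rw [Real.norm_of_nonneg (by positivity)]
    · exact .of_forall fun x => by
        rw [norm_norm]; exact SchwartzMap.norm_le_seminorm ℝ f x
  refine hi.mono' ?_ (.of_forall fun ξ => ?_)
  · refine Continuous.aestronglyMeasurable ?_
    refine Continuous.mul ?_ (by fun_prop)
    exact Continuous.rpow_const (by fun_prop) fun x => Or.inl (by positivity)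
  · rw [Real.norm_of_nonneg (by positivity)]
    have : (1 + ξ ^ 2) ^ s ≤ (1 + ξ ^ 2) ^ n := by
      rw [← Real.rpow_natCast (1 + ξ ^ 2) n]
      exact Real.rpow_le_rpow_of_exponent_le (le_add_of_nonneg_right (sq_nonneg ξ)) hn
    calc _ ≤ (1 + ξ ^ 2) ^ n * ‖f ξ‖ ^ 2 := by gcongr
      _ = _ := by ring

theorem cs_sq {a b : ℝ → ENNReal} (ha : Measurable a) (hb : Measurable b) :
    (∫⁻ t, a t * b t) ^ 2 ≤ (∫⁻ t, a t ^ 2) * ∫⁻ t, b t ^ 2 := by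
  have h := ENNReal.lintegral_mul_le_Lp_mul_Lq volume (Real.HolderConjugate.two_two)
    ha.aemeasurable hb.aemeasurable
  simp only [Pi.mul_apply, ENNReal.rpow_two] at h
  calc _ ≤ ((∫⁻ t, a t ^ 2) ^ (1 / 2 : ℝ) * (∫⁻ t, b t ^ 2) ^ (1 / 2 : ℝ)) ^ 2 := by gcongr
    _ = _ := by
      rw [mul_pow, ← ENNReal.rpow_two, ← ENNReal.rpow_two, ← ENNReal.rpow_mul, ← ENNReal.rpow_mul]
      norm_num

theorem conv_one {w a b : ℝ → ENNReal} (hw : Measurable w) (ha : Measurable a)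
    (hb : Measurable b) :
    ∫⁻ ξ, (∫⁻ t, w t * (a t * b (ξ - t))) ^ 2
      ≤ (∫⁻ t, w t ^ 2) * ((∫⁻ t, a t ^ 2) * ∫⁻ t, b t ^ 2) := by
  calc _ ≤ ∫⁻ ξ, (∫⁻ t, w t ^ 2) * ∫⁻ t, (a t * b (ξ - t)) ^ 2 := by
        gcongr with ξ
        exact cs_sq hw (by fun_prop)
    _ = (∫⁻ t, w t ^ 2) * ∫⁻ ξ, ∫⁻ t, (a t * b (ξ - t)) ^ 2 := by
        rw [lintegral_const_mul]
        have hm : Measurable (fun p : ℝ × ℝ => (a p.2 * b (p.1 - p.2)) ^ 2) := by fun_prop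
        exact hm.lintegral_prod_right'
    _ = (∫⁻ t, w t ^ 2) * ∫⁻ t, ∫⁻ ξ, (a t * b (ξ - t)) ^ 2 := by
        rw [lintegral_lintegral_swap]
        apply Measurable.aemeasurable
        change Measurable (fun p : ℝ × ℝ => (a p.2 * b (p.1 - p.2)) ^ 2)
        fun_prop
    _ = _ := by
        congr 1
        rw [← lintegral_mul_const _ (by fun_prop)]
        congr 1
        ext t
        simp only [mul_pow]
        rw [lintegral_const_mul _ (by fun_prop), lintegral_sub_right_eq_self (fun x => b x ^ 2) t]

theorem conv_two {w a b : ℝ → ENNReal} (hw : Measurable w) (ha : Measurable a)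
    (hb : Measurable b) :
    ∫⁻ ξ, (w ξ * ∫⁻ t, (a t * b (ξ - t))) ^ 2
      ≤ (∫⁻ t, w t ^ 2) * ((∫⁻ t, a t ^ 2) * ∫⁻ t, b t ^ 2) := by
  rw [← lintegral_mul_const _ (by fun_prop)]
  gcongr with ξ
  rw [mul_pow]
  gcongr
  refine (cs_sq ha (by fun_prop)).trans_eq ?_
  rw [lintegral_sub_left_eq_self (fun x => b x ^ 2) ξ]

theorem weight_aux {s x y z : ℝ} (hs : 1 ≤ s) (hx : 1 ≤ x) (hy : 1 ≤ y) (hz : 1 ≤ z)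
    (h1 : x ≤ 2 * (y + z)) (h2 : z ≤ 2 * (x + y)) :
    x ^ (s - 2) * z ^ (2 - s) ≤ 4 ^ |s - 2| * (y ^ s * (y⁻¹ + x⁻¹)) := by
  have x0 : 0 < x := by linarith
  have y0 : 0 < y := by linarith
  have z0 : 0 < z := by linarith
  have ys : 1 ≤ y ^ s * y⁻¹ := by
    rw [← Real.rpow_neg_one, ← Real.rpow_add y0]
    exact Real.one_le_rpow hy (by linarith)
  have yx : 0 ≤ y ^ s * x⁻¹ := by positivity
  rcases le_or_gt 2 s with h | h
  · rw [abs_of_nonneg (by linarith)]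
    suffices x ^ (s - 2) ≤ 4 ^ (s - 2) * (y ^ s * y⁻¹) * z ^ (s - 2) by
      have e : z ^ (2 - s) = (z ^ (s - 2))⁻¹ := by rw [← Real.rpow_neg z0.le]; ring_nf
      rw [e, ← div_eq_mul_inv, div_le_iff₀ (by positivity)]
      refine this.trans ?_
      gcongr
      exact le_add_of_nonneg_right (by positivity)
    have hz1 : 1 ≤ z ^ (s - 2) := Real.one_le_rpow hz (by linarith)
    rcases le_total y z with c | c
    · calc x ^ (s - 2) ≤ (4 * z) ^ (s - 2) := by gcongr <;> linarith
        _ = 4 ^ (s - 2) * 1 * z ^ (s - 2) := by rw [Real.mul_rpow (by norm_num) z0.le]; ring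
        _ ≤ _ := by gcongr
    · calc x ^ (s - 2) ≤ (4 * y) ^ (s - 2) := by gcongr <;> linarith
        _ = 4 ^ (s - 2) * y ^ (s - 2) * 1 := by rw [Real.mul_rpow (by norm_num) y0.le]; ring
        _ ≤ _ := by
          gcongr
          rw [← Real.rpow_neg_one, ← Real.rpow_add y0]
          exact Real.rpow_le_rpow_of_exponent_le hy (by linarith)
  · rw [abs_of_neg (by linarith), neg_sub]
    have e : x ^ (s - 2) = (x ^ (2 - s))⁻¹ := by rw [← Real.rpow_neg x0.le]; ring_nf
    rcases le_total y x with c | c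
    · calc x ^ (s - 2) * z ^ (2 - s) ≤ x ^ (s - 2) * (4 * x) ^ (2 - s) := by
            gcongr <;> linarith
        _ = 4 ^ (2 - s) * 1 := by
            rw [Real.mul_rpow (by norm_num) x0.le, e]
            field_simp
        _ ≤ _ := by gcongr; linarith
    · calc x ^ (s - 2) * z ^ (2 - s) ≤ x ^ (s - 2) * (4 * y) ^ (2 - s) := by
            gcongr <;> linarith
        _ = 4 ^ (2 - s) * (x ^ (s - 2) * y ^ (2 - s)) := by
            rw [Real.mul_rpow (by norm_num) y0.le]; ring
        _ = 4 ^ (2 - s) * ((x ^ (s - 1) * y ^ (2 - s)) * x⁻¹) := by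
            rw [show s - 1 = (s - 2) + 1 by ring, Real.rpow_add x0, Real.rpow_one]
            field_simp
        _ ≤ 4 ^ (2 - s) * ((y ^ (s - 1) * y ^ (2 - s)) * x⁻¹) := by
            gcongr
        _ ≤ 4 ^ (2 - s) * (y ^ s * x⁻¹) := by
            gcongr
            rw [← Real.rpow_add y0]
            exact Real.rpow_le_rpow_of_exponent_le hy (by linarith)
        _ ≤ _ := by gcongr; exact le_add_of_nonneg_left (by positivity)

theorem half_sq {x : ℝ} (hx : 0 < x) (r : ℝ) : (x ^ (r / 2)) ^ 2 = x ^ r := by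
  rw [← Real.rpow_natCast, ← Real.rpow_mul hx.le]
  norm_num

theorem weight_half {s x y z : ℝ} (hs : 1 ≤ s) (hx : 1 ≤ x) (hy : 1 ≤ y) (hz : 1 ≤ z)
    (h1 : x ≤ 2 * (y + z)) (h2 : z ≤ 2 * (x + y)) :
    x ^ ((s - 2) / 2) * z ≤ 4 ^ (|s - 2| / 2) *
      (y ^ (s / 2) * z ^ (s / 2) * (y ^ (-1 / 2 : ℝ) + x ^ (-1 / 2 : ℝ))) := by
  have x0 : 0 < x := by linarith
  have y0 : 0 < y := by linarith
  have z0 : 0 < z := by linarith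
  have h := weight_aux hs hx hy hz h1 h2
  have k : x ^ ((s - 2) / 2) * z ^ ((2 - s) / 2) ≤ 4 ^ (|s - 2| / 2) *
      (y ^ (s / 2) * (y ^ (-1 / 2 : ℝ) + x ^ (-1 / 2 : ℝ))) := by
    apply le_of_sq_le_sq _ (by positivity)
    simp only [mul_pow, half_sq x0, half_sq z0, half_sq y0, half_sq (show (0 : ℝ) < 4 by norm_num)]
    refine h.trans ?_
    gcongr
    rw [add_sq, half_sq x0, half_sq y0, Real.rpow_neg_one, Real.rpow_neg_one]
    have : 0 ≤ 2 * y ^ (-1 / 2 : ℝ) * x ^ (-1 / 2 : ℝ) := by positivity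
    linarith
  have e : z = z ^ ((2 - s) / 2) * z ^ (s / 2) := by
    rw [← Real.rpow_add z0, show (2 - s) / 2 + s / 2 = 1 by ring, Real.rpow_one]
  calc x ^ ((s - 2) / 2) * z = (x ^ ((s - 2) / 2) * z ^ ((2 - s) / 2)) * z ^ (s / 2) := by
        rw [mul_assoc, ← e]
    _ ≤ (4 ^ (|s - 2| / 2) * (y ^ (s / 2) * (y ^ (-1 / 2 : ℝ) + x ^ (-1 / 2 : ℝ)))) *
          z ^ (s / 2) := by gcongr
    _ = _ := by ring

theorem sob_lintegral (s : ℝ) (F : SchwartzMap ℝ ℂ) :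
    ∫⁻ ξ : ℝ, (ENNReal.ofReal ((1 + ξ ^ 2) ^ (s / 2) * ‖F ξ‖)) ^ 2
      = ENNReal.ofReal (∫ ξ : ℝ, (1 + ξ ^ 2) ^ s * ‖F ξ‖ ^ 2) := by
  rw [ofReal_integral_eq_lintegral_ofReal (sob_integrable s F)
    (.of_forall fun ξ => by positivity)]
  congr 1
  ext ξ
  rw [← ENNReal.ofReal_pow (by positivity), mul_pow, half_sq (by positivity)]

theorem w_lintegral :
    ∫⁻ ξ : ℝ, (ENNReal.ofReal ((1 + ξ ^ 2) ^ (-1 / 2 : ℝ))) ^ 2 = ENNReal.ofReal π := by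
  rw [← integral_univ_inv_one_add_sq, ofReal_integral_eq_lintegral_ofReal
    integrable_inv_one_add_sq (.of_forall fun ξ => by positivity)]
  congr 1
  ext ξ
  rw [← ENNReal.ofReal_pow (by positivity), half_sq (by positivity), Real.rpow_neg_one]

theorem add_sq_le_four (a b : ENNReal) : (a + b) ^ 2 ≤ 4 * (a ^ 2 + b ^ 2) := by
  rcases le_total a b with h | h
  · calc (a + b) ^ 2 ≤ (b + b) ^ 2 := by gcongr
      _ = 4 * b ^ 2 := by ring
      _ ≤ _ := by gcongr; exact le_add_self
  · calc (a + b) ^ 2 ≤ (a + a) ^ 2 := by gcongr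
      _ = 4 * a ^ 2 := by ring
      _ ≤ _ := by gcongr; exact le_self_add

theorem main_bound {s : ℝ} (hs : 1 ≤ s) (f g : SchwartzMap ℝ ℂ) :
    ∫ ξ : ℝ, (1 + ξ ^ 2) ^ s * ‖((1 : ℂ) + (ξ : ℂ) ^ 2)⁻¹ *
            ft (fun x => f x * (g x - deriv (deriv (⇑g)) x)) ξ‖ ^ 2 ≤
      (4 ^ (|s - 2| / 2)) ^ 2 * (8 * π) * ((∫ ξ : ℝ, (1 + ξ ^ 2) ^ s * ‖ft f ξ‖ ^ 2) *
        ∫ ξ : ℝ, (1 + ξ ^ 2) ^ s * ‖ft g ξ‖ ^ 2) := by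
  obtain ⟨F, hF⟩ := ft_schwartz f
  obtain ⟨G, hG⟩ := ft_schwartz g
  obtain ⟨h, hh, hH⟩ := ft_bessel g
  simp only [← hh, hF, hG]
  set c : ℝ := 4 ^ (|s - 2| / 2) with hc
  have c0 : 0 ≤ c := by positivity
  set A := ∫ ξ : ℝ, (1 + ξ ^ 2) ^ s * ‖F ξ‖ ^ 2 with hA
  set B := ∫ ξ : ℝ, (1 + ξ ^ 2) ^ s * ‖G ξ‖ ^ 2 with hB
  have A0 : 0 ≤ A := integral_nonneg fun ξ => by positivity
  have B0 : 0 ≤ B := integral_nonneg fun ξ => by positivity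
  let w : ℝ → ENNReal := fun ξ => ENNReal.ofReal ((1 + ξ ^ 2) ^ (-1 / 2 : ℝ))
  let a : ℝ → ENNReal := fun ξ => ENNReal.ofReal ((1 + ξ ^ 2) ^ (s / 2) * ‖F ξ‖)
  let b : ℝ → ENNReal := fun ξ => ENNReal.ofReal ((1 + ξ ^ 2) ^ (s / 2) * ‖G ξ‖)
  have mw : Measurable w := by fun_prop
  have ma : Measurable a := by
    have := F.continuous.measurable
    fun_prop
  have mb : Measurable b := by
    have := G.continuous.measurable
    fun_prop
  have pt : ∀ ξ : ℝ, ENNReal.ofReal ‖(1 + ξ ^ 2) ^ s * ‖((1 : ℂ) + (ξ : ℂ) ^ 2)⁻¹ *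
      ft (fun x => f x * h x) ξ‖ ^ 2‖ ≤ ENNReal.ofReal c ^ 2 * (4 *
        ((∫⁻ t, w t * (a t * b (ξ - t))) ^ 2 + (w ξ * ∫⁻ t, (a t * b (ξ - t))) ^ 2)) := by
    intro ξ
    have x0 : 0 < 1 + ξ ^ 2 := by positivity
    have e1 : ENNReal.ofReal ‖(1 + ξ ^ 2) ^ s * ‖((1 : ℂ) + (ξ : ℂ) ^ 2)⁻¹ *
      ft (fun x => f x * h x) ξ‖ ^ 2‖ = (ENNReal.ofReal ((1 + ξ ^ 2) ^ ((s - 2) / 2)) *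
        ‖ft (fun x => f x * h x) ξ‖ₑ) ^ 2 := by
      rw [← ofReal_norm, ← ENNReal.ofReal_mul (by positivity),
        ← ENNReal.ofReal_pow (by positivity), Real.norm_of_nonneg (by positivity)]
      congr 1
      rw [norm_mul, norm_inv, mul_pow, mul_pow, half_sq x0, Real.rpow_sub x0]
      have : ‖(1 : ℂ) + (ξ : ℂ) ^ 2‖ = 1 + ξ ^ 2 := by
        rw [← Real.norm_of_nonneg x0.le, ← Complex.norm_real]; push_cast; rfl
      rw [this, Real.rpow_two]
      field_simp
    rw [e1]
    refine le_trans ?_ (mul_le_mul_right (add_sq_le_four _ _) _)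
    rw [← mul_pow]
    refine pow_le_pow_left' ?_ 2
    calc _ ≤ ENNReal.ofReal ((1 + ξ ^ 2) ^ ((s - 2) / 2)) *
          ∫⁻ t, ‖ft f t‖ₑ * ‖ft h (ξ - t)‖ₑ := by gcongr; exact ft_prod f h ξ
      _ = ∫⁻ t, ENNReal.ofReal ((1 + ξ ^ 2) ^ ((s - 2) / 2)) *
          (‖ft f t‖ₑ * ‖ft h (ξ - t)‖ₑ) := by
            rw [lintegral_const_mul' _ _ ENNReal.ofReal_ne_top]
      _ ≤ ∫⁻ t, ENNReal.ofReal c * (w t * (a t * b (ξ - t)) + w ξ * (a t * b (ξ - t))) := by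
            refine lintegral_mono fun t => ?_
            rw [← ofReal_norm, ← ofReal_norm, hH, hF, hG]
            simp only [w, a, b]
            have y0 : 0 < 1 + t ^ 2 := by positivity
            have z0 : 0 < 1 + (ξ - t) ^ 2 := by positivity
            repeat rw [← ENNReal.ofReal_mul (by positivity)]
            rw [← ENNReal.ofReal_add (by positivity) (by positivity),
              ← ENNReal.ofReal_mul (by positivity)]
            apply ENNReal.ofReal_le_ofReal
            have k := weight_half (s := s) (x := 1 + ξ ^ 2) (y := 1 + t ^ 2)
              (z := 1 + (ξ - t) ^ 2) hs (le_add_of_nonneg_right (sq_nonneg _))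
              (le_add_of_nonneg_right (sq_nonneg _)) (le_add_of_nonneg_right (sq_nonneg _))
              (by nlinarith [sq_nonneg (ξ - 2 * t)])
              (by nlinarith [sq_nonneg (ξ + t)])
            have k2 := mul_le_mul_of_nonneg_right k
              (show 0 ≤ ‖F t‖ * ‖G (ξ - t)‖ by positivity)
            rw [← hc] at k2
            refine le_trans (le_of_eq ?_) (k2.trans (le_of_eq ?_)) <;> ring
      _ = _ := by
            rw [lintegral_const_mul' _ _ ENNReal.ofReal_ne_top, lintegral_add_left (by fun_prop),
              lintegral_const_mul' (w ξ) _ ENNReal.ofReal_ne_top]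
  have fin : ∫⁻ ξ : ℝ, ENNReal.ofReal ‖(1 + ξ ^ 2) ^ s * ‖((1 : ℂ) + (ξ : ℂ) ^ 2)⁻¹ *
      ft (fun x => f x * h x) ξ‖ ^ 2‖ ≤ ENNReal.ofReal (c ^ 2 * (8 * π) * (A * B)) := by
    have m1 : Measurable fun ξ => (∫⁻ t, w t * (a t * b (ξ - t))) ^ 2 := by
      have hm : Measurable (fun p : ℝ × ℝ => w p.2 * (a p.2 * b (p.1 - p.2))) := by fun_prop
      exact hm.lintegral_prod_right'.pow_const 2
    have n1 := conv_one mw ma mb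
    have n2 := conv_two mw ma mb
    have ea : ∫⁻ t, a t ^ 2 = ENNReal.ofReal A := sob_lintegral s F
    have eb : ∫⁻ t, b t ^ 2 = ENNReal.ofReal B := sob_lintegral s G
    have ew : ∫⁻ t, w t ^ 2 = ENNReal.ofReal π := w_lintegral
    rw [ea, eb, ew] at n1 n2
    refine (lintegral_mono pt).trans ?_
    rw [lintegral_const_mul' _ _ (by finiteness), lintegral_const_mul' _ _ (by finiteness),
      lintegral_add_left m1]
    refine (mul_le_mul_right (mul_le_mul_right (add_le_add n1 n2) _) _).trans_eq ?_
    rw [ENNReal.ofReal_mul (by positivity), ENNReal.ofReal_mul (by positivity),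
      ENNReal.ofReal_mul (by positivity), ENNReal.ofReal_mul (by positivity),
      ENNReal.ofReal_pow c0]
    norm_num
    ring
  refine (le_abs_self _).trans ?_
  rw [← Real.norm_eq_abs]
  refine (norm_integral_le_lintegral_norm _).trans ?_
  exact ENNReal.toReal_le_of_le_ofReal (by positivity) fin

theorem conjugated_multiplication_bounded (s : ℝ) (hs : s ≥ 1) :
    ∃ C > 0, ∀ f g : SchwartzMap ℝ ℂ,
      sobNormF s (fun ξ =>
          ((1 : ℂ) + (ξ : ℂ) ^ 2)⁻¹ *
            ft (fun x => f x * (g x - deriv (deriv (⇑g)) x)) ξ)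
        ≤ C * sobNorm s f * sobNorm s g := by
  refine ⟨((4 ^ (|s - 2| / 2)) ^ 2 * (8 * π)) ^ (1 / 2 : ℝ), by positivity, fun f g => ?_⟩
  have hm := main_bound hs f g
  unfold sobNorm sobNormF
  have A0 : 0 ≤ ∫ ξ : ℝ, (1 + ξ ^ 2) ^ s * ‖ft f ξ‖ ^ 2 :=
    integral_nonneg fun ξ => by positivity
  have B0 : 0 ≤ ∫ ξ : ℝ, (1 + ξ ^ 2) ^ s * ‖ft g ξ‖ ^ 2 :=
    integral_nonneg fun ξ => by positivity
  rw [mul_assoc, ← Real.mul_rpow A0 B0, ← Real.mul_rpow (by positivity) (mul_nonneg A0 B0)]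
  exact Real.rpow_le_rpow (integral_nonneg fun ξ => by positivity) hm (by norm_num)
end

section
/- Let s_h ≥ 0, let s > 1/2 with s ≥ s_h/2, and let G, H : ℝ → ℝ be measurable functions with |G(ξ)| ≤ C₀ (1+ξ²)^{-s_h/2} and |H(ξ)| ≤ C₀ (1+ξ²)^{s_h/2} for all ξ and some C₀ > 0. Then there exists C > 0 such that for every real ε with 0 < |ε| ≤ 1 and all Schwartz functions v, w : ℝ → ℂ one has ‖G(εD)( v · H(εD)w )‖_{H^s} ≤ C |ε|^{-s_h} ‖v‖_{H^s} ‖w‖_{H^s}. -/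
open MeasureTheory Filter Topology

/-- The inverse Fourier transform `(2π)^{-1} ∫ F(ξ) e^{iξx} dξ`. -/
noncomputable def invft (F : ℝ → ℂ) (x : ℝ) : ℂ :=
  (2 * Real.pi)⁻¹ * ∫ ξ : ℝ, F ξ * Complex.exp (Complex.I * (ξ : ℂ) * (x : ℂ))

open scoped ENNReal in
theorem sbe_add_sq (a b : ℝ≥0∞) : (a + b) ^ 2 ≤ 4 * a ^ 2 + 4 * b ^ 2 := by
  rcases le_total a b with h | h
  · calc (a + b) ^ 2 ≤ (b + b) ^ 2 := by gcongr
      _ = 4 * b ^ 2 := by ring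
      _ ≤ _ := le_add_self
  · calc (a + b) ^ 2 ≤ (a + a) ^ 2 := by gcongr
      _ = 4 * a ^ 2 := by ring
      _ ≤ _ := le_self_add

open scoped ENNReal in
theorem sbe_cs (f g : ℝ → ℝ≥0∞) (hf : Measurable f) (hg : Measurable g) :
    (∫⁻ x, f x * g x) ^ 2 ≤ (∫⁻ x, f x ^ 2) * ∫⁻ x, g x ^ 2 := by
  have h := ENNReal.lintegral_mul_le_Lp_mul_Lq volume Real.HolderConjugate.two_two
    hf.aemeasurable hg.aemeasurable
  have h2 := pow_le_pow_left' h 2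
  simp only [Pi.mul_apply, mul_pow] at h2
  have e : ∀ t : ℝ≥0∞, (t ^ (1 / 2 : ℝ)) ^ 2 = t := by
    intro t
    rw [← ENNReal.rpow_natCast, ← ENNReal.rpow_mul]; norm_num
  simpa [e, ← one_div] using h2

open scoped ENNReal in
theorem sbe_core (a f g : ℝ → ℝ≥0∞) (ha : Measurable a) (hf : Measurable f) (hg : Measurable g) :
    ∫⁻ ξ, (∫⁻ η, (a ξ + a η + a (ξ - η)) * (f η * g (ξ - η))) ^ 2
      ≤ 36 * (∫⁻ x, a x ^ 2) * (∫⁻ x, f x ^ 2) * (∫⁻ x, g x ^ 2) := by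
  set J := ∫⁻ x, a x ^ 2
  set N := ∫⁻ x, f x ^ 2 with hN
  set M := ∫⁻ x, g x ^ 2 with hM
  have hconv : ∫⁻ ξ, ∫⁻ η, f η ^ 2 * g (ξ - η) ^ 2 = N * M := by
    rw [lintegral_lintegral_swap (by fun_prop)]
    have : ∀ η, ∫⁻ ξ, f η ^ 2 * g (ξ - η) ^ 2 = f η ^ 2 * M := by
      intro η
      rw [lintegral_const_mul _ (by fun_prop),
        lintegral_sub_right_eq_self (fun x => g x ^ 2) η]
    simp_rw [this]
    rw [lintegral_mul_const _ (by fun_prop)]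
  have hpt : ∀ ξ, (∫⁻ η, (a ξ + a η + a (ξ - η)) * (f η * g (ξ - η))) ^ 2
      ≤ 4 * (a ξ ^ 2 * (N * M)) + 32 * (J * ∫⁻ η, f η ^ 2 * g (ξ - η) ^ 2) := by
    intro ξ
    have e : ∫⁻ η, (a ξ + a η + a (ξ - η)) * (f η * g (ξ - η)) =
        a ξ * (∫⁻ η, f η * g (ξ - η)) + ((∫⁻ η, a η * (f η * g (ξ - η)))
          + ∫⁻ η, a (ξ - η) * (f η * g (ξ - η))) := by
      rw [← lintegral_const_mul _ (by fun_prop), ← lintegral_add_left (by fun_prop),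
        ← lintegral_add_left (by fun_prop)]
      congr 1; ext η; ring
    have h1 : (∫⁻ η, f η * g (ξ - η)) ^ 2 ≤ N * M := by
      refine (sbe_cs f (fun η => g (ξ - η)) hf (by fun_prop)).trans ?_
      rw [lintegral_sub_left_eq_self (fun x => g x ^ 2) ξ]
    have h2 : (∫⁻ η, a η * (f η * g (ξ - η))) ^ 2 ≤ J * ∫⁻ η, f η ^ 2 * g (ξ - η) ^ 2 := by
      refine (sbe_cs a (fun η => f η * g (ξ - η)) ha (by fun_prop)).trans ?_
      simp_rw [mul_pow]; rfl
    have h3 : (∫⁻ η, a (ξ - η) * (f η * g (ξ - η))) ^ 2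
        ≤ J * ∫⁻ η, f η ^ 2 * g (ξ - η) ^ 2 := by
      refine (sbe_cs (fun η => a (ξ - η)) (fun η => f η * g (ξ - η))
        (by fun_prop) (by fun_prop)).trans ?_
      rw [lintegral_sub_left_eq_self (fun x => a x ^ 2) ξ]
      simp_rw [mul_pow]; rfl
    rw [e]
    refine (sbe_add_sq _ _).trans ?_
    rw [mul_pow]
    refine add_le_add (by gcongr) ?_
    refine (mul_le_mul_right (sbe_add_sq _ _) 4).trans ?_
    calc _ ≤ 4 * (4 * (J * ∫⁻ η, f η ^ 2 * g (ξ - η) ^ 2)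
          + 4 * (J * ∫⁻ η, f η ^ 2 * g (ξ - η) ^ 2)) := by gcongr
      _ = 32 * (J * ∫⁻ η, f η ^ 2 * g (ξ - η) ^ 2) := by ring
  refine (lintegral_mono hpt).trans ?_
  have hm : Measurable fun ξ => ∫⁻ η, f η ^ 2 * g (ξ - η) ^ 2 := by
    apply Measurable.lintegral_prod_right'
      (f := fun p : ℝ × ℝ => f p.2 ^ 2 * g (p.1 - p.2) ^ 2)
    fun_prop
  rw [lintegral_add_left (by fun_prop), lintegral_const_mul _ (by fun_prop),
    lintegral_mul_const _ (by fun_prop), lintegral_const_mul _ (by fun_prop),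
    lintegral_const_mul _ hm, hconv]
  apply le_of_eq
  ring

theorem sbe_ptw_aux (σ a x y z : ℝ) (ha : 0 ≤ a) (haσ : a ≤ σ)
    (hx : 1 ≤ x) (hy : 1 ≤ y) (hz : 1 ≤ z) (h : x ≤ 2 * y + 2 * z) :
    x ^ a * y ^ (-a) * z ^ (-σ) ≤ 4 ^ σ * (y ^ (-σ) + z ^ (-σ)) := by
  have hx0 : 0 < x := by linarith
  have hy0 : 0 < y := by linarith
  have hz0 : 0 < z := by linarith
  have h4 : (4 : ℝ) ^ a ≤ 4 ^ σ := Real.rpow_le_rpow_of_exponent_le (by norm_num) haσ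
  rcases le_total z y with hzy | hzy
  · have h1 : x ^ a ≤ 4 ^ a * y ^ a := by
      rw [← Real.mul_rpow (by norm_num) hy0.le]
      exact Real.rpow_le_rpow hx0.le (by linarith) ha
    calc x ^ a * y ^ (-a) * z ^ (-σ) ≤ 4 ^ a * y ^ a * y ^ (-a) * z ^ (-σ) := by gcongr
      _ = 4 ^ a * z ^ (-σ) := by
        rw [mul_assoc (4 ^ a), ← Real.rpow_add hy0]; simp
      _ ≤ 4 ^ σ * (y ^ (-σ) + z ^ (-σ)) := by
        gcongr
        have : 0 < y ^ (-σ) := by positivity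
        linarith
  · have h1 : x ^ a ≤ 4 ^ a * z ^ a := by
      rw [← Real.mul_rpow (by norm_num) hz0.le]
      exact Real.rpow_le_rpow hx0.le (by linarith) ha
    have h2 : z ^ (a - σ) ≤ y ^ (a - σ) :=
      Real.rpow_le_rpow_of_nonpos hy0 hzy (by linarith)
    calc x ^ a * y ^ (-a) * z ^ (-σ) ≤ 4 ^ a * z ^ a * y ^ (-a) * z ^ (-σ) := by gcongr
      _ = 4 ^ a * y ^ (-a) * z ^ (a - σ) := by
        rw [sub_eq_add_neg, Real.rpow_add hz0]; ring
      _ ≤ 4 ^ σ * y ^ (-a) * y ^ (a - σ) := by gcongr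
      _ = 4 ^ σ * y ^ (-σ) := by
        rw [mul_assoc, ← Real.rpow_add hy0]; ring_nf
      _ ≤ _ := by
        gcongr
        have : 0 < z ^ (-σ) := by positivity
        linarith

theorem sbe_ptw (σ a x y z : ℝ) (ha : -σ ≤ a) (haσ : a ≤ σ)
    (hx : 1 ≤ x) (hy : 1 ≤ y) (hz : 1 ≤ z) (h : x ≤ 2 * y + 2 * z) (hyx : y ≤ 2 * x + 2 * z) :
    x ^ a * y ^ (-a) * z ^ (-σ) ≤ 4 ^ σ * (x ^ (-σ) + y ^ (-σ) + z ^ (-σ)) := by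
  have hx0 : 0 < x ^ (-σ) := Real.rpow_pos_of_pos (by linarith) _
  have hy0 : 0 < y ^ (-σ) := Real.rpow_pos_of_pos (by linarith) _
  rcases le_total 0 a with h0 | h0
  · refine (sbe_ptw_aux σ a x y z h0 haσ hx hy hz h).trans ?_
    gcongr; linarith
  · have := sbe_ptw_aux σ (-a) y x z (by linarith) (by linarith) hy hx hz hyx
    rw [neg_neg, mul_comm (y ^ (-a))] at this
    refine this.trans ?_
    gcongr; linarith

theorem sbe_kernel (sh s : ℝ) (hsh : sh ≥ 0) (hssh : s ≥ sh / 2)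
    (G H : ℝ → ℝ) (C₀ : ℝ) (hC₀ : C₀ > 0)
    (hG : ∀ ξ : ℝ, |G ξ| ≤ C₀ * (1 + ξ ^ 2) ^ (-sh / 2))
    (hH : ∀ ξ : ℝ, |H ξ| ≤ C₀ * (1 + ξ ^ 2) ^ (sh / 2))
    (ε : ℝ) (h0 : 0 < |ε|) (h1 : |ε| ≤ 1) (ξ η : ℝ) :
    (1 + ξ ^ 2) ^ (s / 2) * |G (ε * ξ)| * |H (ε * η)| ≤
      C₀ ^ 2 * |ε| ^ (-sh) * 4 ^ (s / 2) *
        ((1 + ξ ^ 2) ^ (-(s / 2)) + (1 + η ^ 2) ^ (-(s / 2)) + (1 + (ξ - η) ^ 2) ^ (-(s / 2)))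
        * ((1 + η ^ 2) ^ (s / 2) * (1 + (ξ - η) ^ 2) ^ (s / 2)) := by
  have hε2 : ε ^ 2 ≤ 1 := by rw [← sq_abs]; nlinarith
  have hε2' : 0 < ε ^ 2 := by rw [← sq_abs]; positivity
  have hp := sbe_ptw (s / 2) (s / 2 - sh / 2) (1 + ξ ^ 2) (1 + η ^ 2) (1 + (ξ - η) ^ 2)
    (by linarith) (by linarith) (by nlinarith) (by nlinarith) (by nlinarith)
    (by nlinarith [sq_nonneg (η - (ξ - η))]) (by nlinarith [sq_nonneg (ξ + (ξ - η))])
  set x := 1 + ξ ^ 2 with hx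
  set y := 1 + η ^ 2 with hy
  set z := 1 + (ξ - η) ^ 2 with hz
  have hx0 : 0 < x := by positivity
  have hy0 : 0 < y := by positivity
  have hz0 : 0 < z := by positivity
  have hG' : |G (ε * ξ)| ≤ C₀ * (|ε| ^ (-sh) * x ^ (-sh / 2)) := by
    refine (hG _).trans ?_
    gcongr
    have e : |ε| ^ (-sh) = (ε ^ 2) ^ (-sh / 2) := by
      rw [← sq_abs, ← Real.rpow_natCast, ← Real.rpow_mul h0.le]; congr 1; push_cast; ring
    rw [e, ← Real.mul_rpow hε2'.le hx0.le]
    exact Real.rpow_le_rpow_of_nonpos (by positivity) (by rw [hx]; nlinarith) (by linarith)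
  have hH' : |H (ε * η)| ≤ C₀ * y ^ (sh / 2) := by
    refine (hH _).trans ?_
    have hle : 1 + (ε * η) ^ 2 ≤ y := by rw [hy]; nlinarith [sq_nonneg η]
    gcongr 1
    exact Real.rpow_le_rpow (by positivity) hle (by linarith)
  calc x ^ (s / 2) * |G (ε * ξ)| * |H (ε * η)|
      ≤ x ^ (s / 2) * (C₀ * (|ε| ^ (-sh) * x ^ (-sh / 2))) * (C₀ * y ^ (sh / 2)) := by gcongr
    _ = C₀ ^ 2 * |ε| ^ (-sh) * (x ^ (s / 2 - sh / 2) * y ^ (-(s / 2 - sh / 2)) * z ^ (-(s / 2)))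
          * (y ^ (s / 2) * z ^ (s / 2)) := by
        have e1 : x ^ (s / 2 - sh / 2) = x ^ (s / 2) * x ^ (-sh / 2) := by
          rw [← Real.rpow_add hx0]; ring_nf
        have e2 : y ^ (sh / 2) = y ^ (-(s / 2 - sh / 2)) * y ^ (s / 2) := by
          rw [← Real.rpow_add hy0]; ring_nf
        have e3 : z ^ (-(s / 2)) * z ^ (s / 2) = 1 := by
          rw [← Real.rpow_add hz0]; simp
        rw [e1, e2]
        linear_combination (-(C₀ ^ 2 * |ε| ^ (-sh) * (x ^ (s / 2) * x ^ (-sh / 2)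
          * y ^ (-(s / 2 - sh / 2))) * y ^ (s / 2))) * e3
    _ ≤ C₀ ^ 2 * |ε| ^ (-sh) * (4 ^ (s / 2) * (x ^ (-(s / 2)) + y ^ (-(s / 2)) + z ^ (-(s / 2))))
          * (y ^ (s / 2) * z ^ (s / 2)) := by gcongr
    _ = _ := by ring

open scoped FourierTransform in
theorem sbe_ft_eq (v : SchwartzMap ℝ ℂ) (ξ : ℝ) :
    ft (⇑v) ξ = (𝓕 v : SchwartzMap ℝ ℂ) (ξ / (2 * Real.pi)) := by
  rw [SchwartzMap.fourier_coe, Real.fourier_real_eq_integral_exp_smul, ft]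
  congr 1; ext x
  rw [smul_eq_mul, mul_comm]
  congr 2
  have : (Real.pi : ℂ) ≠ 0 := by exact_mod_cast Real.pi_ne_zero
  push_cast
  field_simp

theorem sbe_ft_cont (v : SchwartzMap ℝ ℂ) : Continuous (ft (⇑v)) := by
  have : ft (⇑v) = fun ξ => _ := funext (sbe_ft_eq v)
  rw [this]
  fun_prop

open scoped FourierTransform in
theorem sbe_decay (v : SchwartzMap ℝ ℂ) (r : ℝ) :
    ∃ C, ∀ ξ : ℝ, (1 + ξ ^ 2) ^ r * ‖ft (⇑v) ξ‖ ≤ C := by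
  obtain ⟨n, hn⟩ := exists_nat_ge r
  refine ⟨((2 * Real.pi) ^ 2) ^ n * (2 ^ (2 * n) * (Finset.Iic ((2 * n, 0) : ℕ × ℕ)).sup
    (fun m => SchwartzMap.seminorm ℝ m.1 m.2) (𝓕 v : SchwartzMap ℝ ℂ)), fun ξ => ?_⟩
  have h := SchwartzMap.one_add_le_sup_seminorm_apply (𝕜 := ℝ) (m := (2 * n, 0)) (k := 2 * n)
    (n := 0) le_rfl le_rfl (𝓕 v : SchwartzMap ℝ ℂ) (ξ / (2 * Real.pi))
  rw [norm_iteratedFDeriv_zero, ← sbe_ft_eq] at h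
  have hπ : 1 ≤ 2 * Real.pi := by linarith [Real.pi_gt_three]
  have h1 : 1 + ξ ^ 2 ≤ (2 * Real.pi) ^ 2 * (1 + ‖ξ / (2 * Real.pi)‖) ^ 2 := by
    rw [← mul_pow, mul_add, Real.norm_eq_abs, abs_div, abs_of_pos (by linarith : 0 < 2 * Real.pi),
      mul_div_cancel₀ _ (by linarith)]
    nlinarith [abs_nonneg ξ, sq_abs ξ]
  calc (1 + ξ ^ 2) ^ r * ‖ft (⇑v) ξ‖ ≤ (1 + ξ ^ 2) ^ n * ‖ft (⇑v) ξ‖ := by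
        gcongr
        rw [← Real.rpow_natCast (1 + ξ ^ 2)]
        exact Real.rpow_le_rpow_of_exponent_le (by nlinarith [sq_nonneg ξ]) hn
    _ ≤ ((2 * Real.pi) ^ 2 * (1 + ‖ξ / (2 * Real.pi)‖) ^ 2) ^ n * ‖ft (⇑v) ξ‖ := by gcongr
    _ = ((2 * Real.pi) ^ 2) ^ n * ((1 + ‖ξ / (2 * Real.pi)‖) ^ (2 * n) * ‖ft (⇑v) ξ‖) := by
        rw [mul_pow, ← pow_mul (1 + _)]; ring
    _ ≤ _ := by gcongr

theorem sbe_contw (r : ℝ) : Continuous fun ξ : ℝ => (1 + ξ ^ 2) ^ r :=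
  Continuous.rpow_const (by fun_prop) (fun x => Or.inl (by positivity))

theorem sbe_int_w (s : ℝ) (hs : s > 1 / 2) : Integrable fun ξ : ℝ => (1 + ξ ^ 2) ^ (-s) := by
  have := integrable_rpow_neg_one_add_norm_sq (E := ℝ) (μ := volume) (r := 2 * s)
    (by simp; linarith)
  convert this using 3
  · simp
  · ring

theorem sbe_int1 (v : SchwartzMap ℝ ℂ) (r : ℝ) :
    Integrable fun ξ : ℝ => (1 + ξ ^ 2) ^ r * ‖ft (⇑v) ξ‖ := by
  obtain ⟨C, hC⟩ := sbe_decay v (r + 1)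
  have hc := sbe_ft_cont v
  have hw := sbe_contw r
  refine ((sbe_int_w 1 (by norm_num)).const_mul C).mono' (by fun_prop) (.of_forall fun ξ => ?_)
  have hx : 0 < 1 + ξ ^ 2 := by positivity
  rw [Real.norm_of_nonneg (by positivity)]
  calc (1 + ξ ^ 2) ^ r * ‖ft (⇑v) ξ‖
      = ((1 + ξ ^ 2) ^ (r + 1) * ‖ft (⇑v) ξ‖) * (1 + ξ ^ 2) ^ (-1 : ℝ) := by
        rw [mul_right_comm, ← Real.rpow_add hx]; ring_nf
    _ ≤ _ := by gcongr; exact hC ξ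

theorem sbe_int2 (v : SchwartzMap ℝ ℂ) (r : ℝ) :
    Integrable fun ξ : ℝ => (1 + ξ ^ 2) ^ r * ‖ft (⇑v) ξ‖ ^ 2 := by
  obtain ⟨C, hC⟩ := sbe_decay v 0
  have hc := sbe_ft_cont v
  have hw := sbe_contw r
  refine ((sbe_int1 v r).mul_const C).mono' (by fun_prop) (.of_forall fun ξ => ?_)
  have hx : 0 < 1 + ξ ^ 2 := by positivity
  rw [Real.norm_of_nonneg (by positivity), pow_two ‖_‖, ← mul_assoc]
  gcongr
  simpa using hC ξ

theorem sbe_conv (v : SchwartzMap ℝ ℂ) (F : ℝ → ℂ) (hF : Integrable F) (ξ : ℝ) :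
    ft (fun x => v x * invft F x) ξ =
      (2 * Real.pi : ℂ)⁻¹ * ∫ η, F η * ft (⇑v) (ξ - η) := by
  have hI : Integrable (Function.uncurry fun x η : ℝ =>
      v x * F η * (Complex.exp (((η * x - ξ * x : ℝ) : ℂ) * Complex.I)))
      (volume.prod volume) := by
    refine (v.integrable.mul_prod hF).mul_bdd (c := 1) ?_ (.of_forall fun p => ?_)
    · apply Continuous.aestronglyMeasurable; fun_prop
    · rw [Complex.norm_exp_ofReal_mul_I]
  have hs := integral_integral_swap hI
  simp only [ft, invft]
  have e1 : ∀ x : ℝ, v x * (((2 * Real.pi)⁻¹ : ℝ) * ∫ η, F η * Complex.exp (Complex.I * η * x))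
      * Complex.exp (-(Complex.I * ξ * x)) = (2 * Real.pi : ℂ)⁻¹ *
      ∫ η : ℝ, v x * F η * (Complex.exp (((η * x - ξ * x : ℝ) : ℂ) * Complex.I)) := by
    intro x
    have : ∀ η : ℝ, v x * F η * (Complex.exp (((η * x - ξ * x : ℝ) : ℂ) * Complex.I)) =
        (v x * Complex.exp (-(Complex.I * ξ * x))) * (F η * Complex.exp (Complex.I * η * x)) := by
      intro η
      have : Complex.exp (((η * x - ξ * x : ℝ) : ℂ) * Complex.I) =
          Complex.exp (-(Complex.I * ξ * x)) * Complex.exp (Complex.I * η * x) := by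
        rw [← Complex.exp_add]; congr 1; push_cast; ring
      rw [this]; ring
    simp_rw [this]
    rw [integral_const_mul]
    push_cast
    ring
  have e2 : ∀ η : ℝ, F η * ∫ x : ℝ, v x * Complex.exp (-(Complex.I * ((ξ - η : ℝ) : ℂ) * x)) =
      ∫ x : ℝ, v x * F η * (Complex.exp (((η * x - ξ * x : ℝ) : ℂ) * Complex.I)) := by
    intro η
    rw [← integral_const_mul]
    congr 1; ext x
    have : -(Complex.I * ((ξ - η : ℝ) : ℂ) * x) = ((η * x - ξ * x : ℝ) : ℂ) * Complex.I := by
      push_cast; ring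
    rw [this]; ring
  simp_rw [e2]
  rw [← hs, ← integral_const_mul]
  congr 1; ext x
  rw [← e1]

/-- `‖G(εD)(v · H(εD)w)‖_{H^s} ≲ |ε|^{-s_h} ‖v‖_{H^s} ‖w‖_{H^s}` for
`|G(ξ)| ≤ C₀ ⟨ξ⟩^{-s_h}`, `|H(ξ)| ≤ C₀ ⟨ξ⟩^{s_h}`, `s > 1/2`, `s ≥ s_h/2`. -/
theorem smoothing_bilinear_estimate (sh s : ℝ) (hsh : sh ≥ 0)
    (hs : s > 1/2) (hssh : s ≥ sh / 2)
    (G H : ℝ → ℝ) (hGmeas : Measurable G) (hHmeas : Measurable H)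
    (C₀ : ℝ) (hC₀ : C₀ > 0)
    (hG : ∀ ξ : ℝ, |G ξ| ≤ C₀ * (1 + ξ ^ 2) ^ (-sh / 2))
    (hH : ∀ ξ : ℝ, |H ξ| ≤ C₀ * (1 + ξ ^ 2) ^ (sh / 2)) :
    ∃ C > 0, ∀ ε : ℝ, 0 < |ε| → |ε| ≤ 1 →
      ∀ v w : SchwartzMap ℝ ℂ,
        sobNormF s (fun ξ =>
            (G (ε * ξ) : ℂ) *
              ft (fun x => v x * invft (fun η => (H (ε * η) : ℂ) * ft (⇑w) η) x) ξ)
          ≤ C * |ε| ^ (-sh) * sobNorm s v * sobNorm s w := by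
  set Jr : ℝ := ∫ ξ : ℝ, (1 + ξ ^ 2) ^ (-s) with hJr
  have hJr0 : 0 ≤ Jr := integral_nonneg fun ξ => by positivity
  refine ⟨C₀ ^ 2 * 4 ^ (s / 2) * (2 * Real.pi)⁻¹ * 6 * Jr ^ (1 / 2 : ℝ) + 1, by positivity, ?_⟩
  intro ε h0 h1 v w
  have hvc := sbe_ft_cont v
  have hwc := sbe_ft_cont w
  have hF : Integrable fun η => (H (ε * η) : ℂ) * ft (⇑w) η := by
    refine ((sbe_int1 w (sh / 2)).const_mul C₀).mono'
      (Measurable.aestronglyMeasurable (by fun_prop)) (.of_forall fun η => ?_)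
    rw [norm_mul, Complex.norm_real, Real.norm_eq_abs, ← mul_assoc]
    gcongr
    refine (hH _).trans ?_
    have hε2 : ε ^ 2 ≤ 1 := by rw [← sq_abs]; nlinarith
    have hle : 1 + (ε * η) ^ 2 ≤ 1 + η ^ 2 := by nlinarith [sq_nonneg η]
    gcongr 1
    exact Real.rpow_le_rpow (by positivity) hle (by linarith)
  set K : ℝ := C₀ ^ 2 * |ε| ^ (-sh) * 4 ^ (s / 2) * (2 * Real.pi)⁻¹ with hK
  have hK0 : 0 ≤ K := by positivity
  set Nv : ℝ := ∫ ξ : ℝ, (1 + ξ ^ 2) ^ s * ‖ft (⇑v) ξ‖ ^ 2 with hNv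
  set Nw : ℝ := ∫ ξ : ℝ, (1 + ξ ^ 2) ^ s * ‖ft (⇑w) ξ‖ ^ 2 with hNw
  have hNv0 : 0 ≤ Nv := integral_nonneg fun ξ => by positivity
  have hNw0 : 0 ≤ Nw := integral_nonneg fun ξ => by positivity
  have hsq : ∀ x : ℝ, 0 < x → (x ^ (s / 2)) ^ 2 = x ^ s := fun x hx => by
    rw [← Real.rpow_natCast, ← Real.rpow_mul hx.le]; congr 1; push_cast; ring
  have hsq' : ∀ x : ℝ, 0 < x → (x ^ (-(s / 2))) ^ 2 = x ^ (-s) := fun x hx => by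
    rw [← Real.rpow_natCast, ← Real.rpow_mul hx.le]; congr 1; push_cast; ring
  let a : ℝ → ENNReal := fun ξ => ENNReal.ofReal ((1 + ξ ^ 2) ^ (-(s / 2)))
  let f : ℝ → ENNReal := fun ξ => ENNReal.ofReal ((1 + ξ ^ 2) ^ (s / 2) * ‖ft (⇑w) ξ‖)
  let g : ℝ → ENNReal := fun ξ => ENNReal.ofReal ((1 + ξ ^ 2) ^ (s / 2) * ‖ft (⇑v) ξ‖)
  have hJe : ∫⁻ x, a x ^ 2 = ENNReal.ofReal Jr := by
    rw [hJr, ofReal_integral_eq_lintegral_ofReal (sbe_int_w s hs)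
      (.of_forall fun ξ => by positivity)]
    congr 1; ext ξ
    rw [← ENNReal.ofReal_pow (by positivity), hsq' _ (by positivity)]
  have hNe : ∫⁻ x, f x ^ 2 = ENNReal.ofReal Nw := by
    rw [hNw, ofReal_integral_eq_lintegral_ofReal (sbe_int2 w s)
      (.of_forall fun ξ => by positivity)]
    congr 1; ext ξ
    rw [← ENNReal.ofReal_pow (by positivity), mul_pow, hsq _ (by positivity)]
  have hMe : ∫⁻ x, g x ^ 2 = ENNReal.ofReal Nv := by
    rw [hNv, ofReal_integral_eq_lintegral_ofReal (sbe_int2 v s)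
      (.of_forall fun ξ => by positivity)]
    congr 1; ext ξ
    rw [← ENNReal.ofReal_pow (by positivity), mul_pow, hsq _ (by positivity)]
  have hcore := sbe_core a f g ((sbe_contw _).measurable.ennreal_ofReal)
    (((sbe_contw _).mul hwc.norm).measurable.ennreal_ofReal)
    (((sbe_contw _).mul hvc.norm).measurable.ennreal_ofReal)
  rw [hJe, hNe, hMe] at hcore
  unfold sobNorm sobNormF
  simp_rw [sbe_conv v _ hF]
  set Φ : ℝ → ℝ := fun ξ => (1 + ξ ^ 2) ^ s * ‖(G (ε * ξ) : ℂ) * ((2 * Real.pi : ℂ)⁻¹ *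
    ∫ η, (H (ε * η) : ℂ) * ft (⇑w) η * ft (⇑v) (ξ - η))‖ ^ 2 with hΦ
  have hpt : ∀ ξ, ENNReal.ofReal ‖Φ ξ‖ ≤ ENNReal.ofReal K ^ 2 *
      (∫⁻ η, (a ξ + a η + a (ξ - η)) * (f η * g (ξ - η))) ^ 2 := by
    intro ξ
    have hx : 0 < 1 + ξ ^ 2 := by positivity
    set c : ℝ := (1 + ξ ^ 2) ^ (s / 2) * |G (ε * ξ)| * (2 * Real.pi)⁻¹ with hc
    have hc0 : 0 ≤ c := by positivity
    have e : ‖Φ ξ‖ = (c * ‖∫ η, (H (ε * η) : ℂ) * ft (⇑w) η * ft (⇑v) (ξ - η)‖) ^ 2 := by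
      rw [Real.norm_of_nonneg (by positivity), hΦ, hc]
      simp only [norm_mul, norm_inv, Complex.norm_real, Complex.norm_ofNat, Real.norm_eq_abs,
        abs_of_pos Real.pi_pos]
      rw [← hsq _ hx]; ring
    rw [e, ENNReal.ofReal_pow (by positivity), ← mul_pow]
    gcongr
    rw [ENNReal.ofReal_mul hc0, ofReal_norm]
    refine (mul_le_mul_right (enorm_integral_le_lintegral_enorm _) _).trans ?_
    rw [← lintegral_const_mul' _ _ ENNReal.ofReal_ne_top,
      ← lintegral_const_mul' _ _ ENNReal.ofReal_ne_top]
    refine lintegral_mono fun η => ?_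
    simp only [a, f, g]
    rw [← ENNReal.ofReal_add (by positivity) (by positivity),
      ← ENNReal.ofReal_add (by positivity) (by positivity),
      ← ENNReal.ofReal_mul (by positivity), ← ENNReal.ofReal_mul (by positivity),
      ← ENNReal.ofReal_mul (by positivity), ← ofReal_norm,
      ← ENNReal.ofReal_mul (by positivity)]
    apply ENNReal.ofReal_le_ofReal
    have hk := sbe_kernel sh s hsh hssh G H C₀ hC₀ hG hH ε h0 h1 ξ η
    rw [norm_mul, norm_mul, Complex.norm_real, Real.norm_eq_abs, hc, hK]
    have hk2 := mul_le_mul_of_nonneg_right hk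
      (by positivity : 0 ≤ (2 * Real.pi)⁻¹ * (‖ft (⇑w) η‖ * ‖ft (⇑v) (ξ - η)‖))
    refine le_trans (le_of_eq ?_) (hk2.trans (le_of_eq ?_)) <;> ring
  have hL : ∫⁻ ξ, ENNReal.ofReal ‖Φ ξ‖ ≤ ENNReal.ofReal (K ^ 2 * (36 * Jr * Nw * Nv)) := by
    refine (lintegral_mono hpt).trans ?_
    rw [lintegral_const_mul' _ _ (by simp),
      ENNReal.ofReal_mul (p := K ^ 2) (by positivity),
      ENNReal.ofReal_pow hK0]
    refine mul_le_mul_right (hcore.trans (le_of_eq ?_)) _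
    rw [ENNReal.ofReal_mul (q := Nv) (by positivity), ENNReal.ofReal_mul (q := Nw) (by positivity),
      ENNReal.ofReal_mul (q := Jr) (by positivity), ENNReal.ofReal_ofNat]
  have hI : ∫ ξ, Φ ξ ≤ K ^ 2 * (36 * Jr * Nw * Nv) := by
    refine (le_abs_self _).trans ((norm_integral_le_lintegral_norm Φ).trans ?_)
    exact ENNReal.toReal_le_of_le_ofReal (by positivity) hL
  have hI0 : 0 ≤ ∫ ξ, Φ ξ := integral_nonneg fun ξ => by positivity
  calc (∫ ξ, Φ ξ) ^ (1 / 2 : ℝ) ≤ (K ^ 2 * (36 * Jr * Nw * Nv)) ^ (1 / 2 : ℝ) :=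
        Real.rpow_le_rpow hI0 hI (by norm_num)
    _ = K * 6 * Jr ^ (1 / 2 : ℝ) * Nv ^ (1 / 2 : ℝ) * Nw ^ (1 / 2 : ℝ) := by
        rw [show K ^ 2 * (36 * Jr * Nw * Nv) = (K * 6) ^ 2 * Jr * Nv * Nw by ring,
          Real.mul_rpow (by positivity) hNw0, Real.mul_rpow (by positivity) hNv0,
          Real.mul_rpow (by positivity) hJr0, ← Real.sqrt_eq_rpow ((K * 6) ^ 2),
          Real.sqrt_sq (by positivity)]
    _ = (C₀ ^ 2 * 4 ^ (s / 2) * (2 * Real.pi)⁻¹ * 6 * Jr ^ (1 / 2 : ℝ)) * |ε| ^ (-sh)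
          * Nv ^ (1 / 2 : ℝ) * Nw ^ (1 / 2 : ℝ) := by rw [hK]; ring
    _ ≤ _ := by
        gcongr
        linarith
end
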